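/- Let U ⊆ ℂ be open and let X = (X₁, X₂, X₃) : ℂ → ℝ³ be a conformal harmonic immersion on U that extends continuously to closure(U), such that the restriction of X to closure(U) is a proper map into ℝ³ (preimages of compact sets are compact), and such that on closure(U) one has 0 ≤ X₃ ≤ b for some constant b and X₁² + X₂² ≥ 1. Then for any two bounded continuous functions f₁, f₂ : closure(U) → ℝ that are harmonic on U and agree on the frontier closure(U) \ U, one has f₁ = f₂ on closure(U). (This is the key step in Theorem 3.1 of the paper — the part M(n,∗) of a properly immersed minimal surface lying in a horizontal slab and outside a vertical cylinder is parabolic — expressed for a conformally parametrized piece.) -/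

import Mathlib

/-- Partial derivative in the direction of `1` (the `x`-direction) of `u : ℂ → ℝ`. -/
noncomputable def pdx (u : ℂ → ℝ) (z : ℂ) : ℝ := fderiv ℝ u z 1

/-- Partial derivative in the direction of `I` (the `y`-direction) of `u : ℂ → ℝ`. -/
noncomputable def pdy (u : ℂ → ℝ) (z : ℂ) : ℝ := fderiv ℝ u z Complex.I

/-- The flat Laplacian `Δu = ∂²u/∂x² + ∂²u/∂y²` of `u : ℂ → ℝ`. -/
noncomputable def lap (u : ℂ → ℝ) (z : ℂ) : ℝ := pdx (pdx u) z + pdy (pdy u) z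

/-- A twice differentiable function of one variable has nonpositive second derivative
at a local maximum. -/
lemma second_deriv_nonpos_of_isLocalMax {φ φ' : ℝ → ℝ} {a c : ℝ}
    (hφ : ∀ᶠ t in nhds a, HasDerivAt φ (φ' t) t) (hφ' : HasDerivAt φ' c a)
    (hmax : IsLocalMax φ a) : c ≤ 0 := by
  by_contra! hc
  have hd : deriv φ =ᶠ[nhds a] φ' := hφ.mono fun t ht => ht.deriv
  have hmin : IsLocalMin φ a := by
    refine isLocalMin_of_deriv_deriv_pos ?_ hmax.deriv_eq_zero hφ.self_of_nhds.continuousAt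
    rw [hd.deriv_eq, hφ'.deriv]
    exact hc
  have hconst : φ =ᶠ[nhds a] fun _ => φ a := by
    filter_upwards [hmax, hmin] with t h₁ h₂ using le_antisymm h₁ h₂
  have hzero : deriv φ =ᶠ[nhds a] fun _ => (0 : ℝ) := by
    simpa using hconst.deriv
  have : HasDerivAt (fun _ => (0 : ℝ)) c a := hφ'.congr_of_eventuallyEq (hzero.symm.trans hd)
  exact hc.ne' (this.unique (hasDerivAt_const a 0))

/-- The restriction of a smooth function to a line has the expected first derivatives near,
and second derivative at, the base point. -/
lemma line_hasDerivAt {U : Set ℂ} (hU : IsOpen U) {u : ℂ → ℝ}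
    (hu : ContDiffOn ℝ (⊤ : ℕ∞) u U) {z : ℂ} (hz : z ∈ U) (e : ℂ) :
    (∀ᶠ t : ℝ in nhds 0,
      HasDerivAt (fun s : ℝ => u (z + s * e)) (fderiv ℝ u (z + t * e) e) t) ∧
    HasDerivAt (fun t : ℝ => fderiv ℝ u (z + t * e) e)
      (fderiv ℝ (fun w => fderiv ℝ u w e) z e) 0 := by
  have hline : ∀ t : ℝ, HasDerivAt (fun s : ℝ => z + s * e) e t := fun t => by
    simpa using ((Complex.ofRealCLM.hasDerivAt (x := t)).mul_const e).const_add z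
  constructor
  · have hmem : ∀ᶠ t : ℝ in nhds 0, z + t * e ∈ U :=
      (hline 0).continuousAt.eventually_mem (hU.mem_nhds (by simpa using hz))
    filter_upwards [hmem] with t ht
    have hd : DifferentiableAt ℝ u (z + t * e) :=
      (hu.contDiffAt (hU.mem_nhds ht)).differentiableAt (by simp)
    exact hd.hasFDerivAt.comp_hasDerivAt t (hline t)
  · have hd : DifferentiableAt ℝ (fun w => fderiv ℝ u w e) z := by
      have h1 : ContDiffAt ℝ 1 (fderiv ℝ u) z :=
        (hu.contDiffAt (hU.mem_nhds hz)).fderiv_right (by norm_cast)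
      exact (h1.differentiableAt (by simp)).clm_apply (differentiableAt_const e)
    have hd' : HasFDerivAt (fun w => fderiv ℝ u w e)
        (fderiv ℝ (fun w => fderiv ℝ u w e) z) (z + (0 : ℝ) * e) := by
      simpa using hd.hasFDerivAt
    exact hd'.comp_hasDerivAt (0 : ℝ) (hline 0)

/-- Horizontal vectors project onto a tangent plane with a definite loss of length: here
`p, q` is an orthogonal frame of length `l` and `(x₁, x₂)` is a horizontal vector. -/
lemma conformal_frame_horizontal {p₁ p₂ p₃ q₁ q₂ q₃ l x₁ x₂ : ℝ} (hl : 0 < l)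
    (horth : p₁ * q₁ + p₂ * q₂ + p₃ * q₃ = 0)
    (hp : p₁ ^ 2 + p₂ ^ 2 + p₃ ^ 2 = l ^ 2) (hq : q₁ ^ 2 + q₂ ^ 2 + q₃ ^ 2 = l ^ 2) :
    (x₁ ^ 2 + x₂ ^ 2) * (l ^ 2 - (p₃ ^ 2 + q₃ ^ 2)) ≤
      (x₁ * p₁ + x₂ * p₂) ^ 2 + (x₁ * q₁ + x₂ * q₂) ^ 2 := by
  have hgram : (x₁ * (p₂ * q₃ - p₃ * q₂) + x₂ * (p₃ * q₁ - p₁ * q₃)) ^ 2 =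
      (x₁ ^ 2 + x₂ ^ 2) * ((p₁ ^ 2 + p₂ ^ 2 + p₃ ^ 2) * (q₁ ^ 2 + q₂ ^ 2 + q₃ ^ 2)
        - (p₁ * q₁ + p₂ * q₂ + p₃ * q₃) ^ 2)
      - (x₁ * p₁ + x₂ * p₂) ^ 2 * (q₁ ^ 2 + q₂ ^ 2 + q₃ ^ 2)
      - (x₁ * q₁ + x₂ * q₂) ^ 2 * (p₁ ^ 2 + p₂ ^ 2 + p₃ ^ 2)
      + 2 * (x₁ * p₁ + x₂ * p₂) * (x₁ * q₁ + x₂ * q₂) * (p₁ * q₁ + p₂ * q₂ + p₃ * q₃) := by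
    ring
  rw [horth, hp, hq] at hgram
  have hnormal : (p₂ * q₃ - p₃ * q₂) ^ 2 + (p₃ * q₁ - p₁ * q₃) ^ 2 =
      l ^ 2 * (p₃ ^ 2 + q₃ ^ 2) := by
    linear_combination q₃ ^ 2 * hp + p₃ ^ 2 * hq - 2 * p₃ * q₃ * horth
  have hcs : (x₁ * (p₂ * q₃ - p₃ * q₂) + x₂ * (p₃ * q₁ - p₁ * q₃)) ^ 2 ≤
      (x₁ ^ 2 + x₂ ^ 2) * ((p₂ * q₃ - p₃ * q₂) ^ 2 + (p₃ * q₁ - p₁ * q₃) ^ 2) := by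
    linarith [sq_nonneg (x₁ * (p₃ * q₁ - p₁ * q₃) - x₂ * (p₂ * q₃ - p₃ * q₂))]
  rw [hnormal] at hcs
  have hl2 : 0 < l ^ 2 := by positivity
  refine le_of_mul_le_mul_left ?_ hl2
  linarith

/-- The function `log (x₁² + x₂² - 1/2) - 6 x₃²` is strictly superharmonic on a conformal minimal
surface outside the unit cylinder, in terms of first derivatives `p, q` of the coordinates. -/
lemma barrier_laplacian_neg {p₁ p₂ p₃ q₁ q₂ q₃ l x₁ x₂ : ℝ} (hl : 0 < l)
    (horth : p₁ * q₁ + p₂ * q₂ + p₃ * q₃ = 0)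
    (hp : p₁ ^ 2 + p₂ ^ 2 + p₃ ^ 2 = l ^ 2) (hq : q₁ ^ 2 + q₂ ^ 2 + q₃ ^ 2 = l ^ 2)
    (hx : 1 ≤ x₁ ^ 2 + x₂ ^ 2) :
    2 * (p₁ ^ 2 + p₂ ^ 2 + q₁ ^ 2 + q₂ ^ 2) / (x₁ ^ 2 + x₂ ^ 2 - 1 / 2)
      - 4 * ((x₁ * p₁ + x₂ * p₂) ^ 2 + (x₁ * q₁ + x₂ * q₂) ^ 2) / (x₁ ^ 2 + x₂ ^ 2 - 1 / 2) ^ 2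
      - 12 * (p₃ ^ 2 + q₃ ^ 2) < 0 := by
  have key := conformal_frame_horizontal (x₁ := x₁) (x₂ := x₂) hl horth hp hq
  set r := x₁ ^ 2 + x₂ ^ 2
  set c := p₃ ^ 2 + q₃ ^ 2
  have hc0 : 0 ≤ c := by positivity
  have hsum : p₁ ^ 2 + p₂ ^ 2 + q₁ ^ 2 + q₂ ^ 2 = 2 * l ^ 2 - c := by linarith
  set S := (x₁ * p₁ + x₂ * p₂) ^ 2 + (x₁ * q₁ + x₂ * q₂) ^ 2
  have hD : 0 < r - 1 / 2 := by linarith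
  have hl2 : 0 < l ^ 2 := by positivity
  have hfac : 2 * (2 * l ^ 2 - c) * (r - 1 / 2) - 4 * S - 12 * c * (r - 1 / 2) ^ 2 < 0 := by
    have : 2 * r + 1 ≤ 12 * (r - 1 / 2) ^ 2 := by nlinarith
    nlinarith [mul_le_mul_of_nonneg_left this hc0]
  have heq : 2 * (2 * l ^ 2 - c) / (r - 1 / 2) - 4 * S / (r - 1 / 2) ^ 2 - 12 * c =
      (2 * (2 * l ^ 2 - c) * (r - 1 / 2) - 4 * S - 12 * c * (r - 1 / 2) ^ 2) /
        (r - 1 / 2) ^ 2 := by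
    have hD0 := hD.ne'
    set D := r - 1 / 2
    field_simp
  rw [hsum, heq]
  exact div_neg_of_neg_of_pos hfac (by positivity)

/-- Second derivative test along a line for `f - k - ε (log (x₁² + x₂² - 1/2) - 6 x₃² + C)`. -/
lemma line_barrier_test {x₁ x₂ x₃ f k x₁' x₂' x₃' f' k' : ℝ → ℝ} {a₁ a₂ a₃ d m ε C : ℝ}
    (h₁ : ∀ᶠ t in nhds 0, HasDerivAt x₁ (x₁' t) t) (h₁' : HasDerivAt x₁' a₁ 0)
    (h₂ : ∀ᶠ t in nhds 0, HasDerivAt x₂ (x₂' t) t) (h₂' : HasDerivAt x₂' a₂ 0)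
    (h₃ : ∀ᶠ t in nhds 0, HasDerivAt x₃ (x₃' t) t) (h₃' : HasDerivAt x₃' a₃ 0)
    (hf : ∀ᶠ t in nhds 0, HasDerivAt f (f' t) t) (hf' : HasDerivAt f' d 0)
    (hk : ∀ᶠ t in nhds 0, HasDerivAt k (k' t) t) (hk' : HasDerivAt k' m 0)
    (hx : 1 ≤ x₁ 0 ^ 2 + x₂ 0 ^ 2)
    (hmax : IsLocalMax (fun t => f t - k t -
      ε * (Real.log (x₁ t ^ 2 + x₂ t ^ 2 - 1 / 2) - 6 * x₃ t ^ 2 + C)) 0) :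
    d - m - ε * ((2 * (x₁' 0 ^ 2 + x₂' 0 ^ 2) + 2 * (x₁ 0 * a₁ + x₂ 0 * a₂)) /
        (x₁ 0 ^ 2 + x₂ 0 ^ 2 - 1 / 2)
      - 4 * (x₁ 0 * x₁' 0 + x₂ 0 * x₂' 0) ^ 2 / (x₁ 0 ^ 2 + x₂ 0 ^ 2 - 1 / 2) ^ 2
      - 12 * (x₃' 0 ^ 2 + x₃ 0 * a₃)) ≤ 0 := by
  have c₁ := h₁.self_of_nhds
  have c₂ := h₂.self_of_nhds
  have c₃ := h₃.self_of_nhds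
  have hD : x₁ 0 ^ 2 + x₂ 0 ^ 2 - 1 / 2 ≠ 0 := by linarith
  have hDev : ∀ᶠ t in nhds 0, x₁ t ^ 2 + x₂ t ^ 2 - 1 / 2 ≠ 0 :=
    (((c₁.continuousAt.pow 2).add (c₂.continuousAt.pow 2)).sub continuousAt_const).eventually_ne hD
  refine second_deriv_nonpos_of_isLocalMax (φ' := fun t => f' t - k' t -
    ε * (2 * (x₁ t * x₁' t + x₂ t * x₂' t) / (x₁ t ^ 2 + x₂ t ^ 2 - 1 / 2) -
      12 * (x₃ t * x₃' t))) ?_ ?_ hmax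
  · filter_upwards [h₁, h₂, h₃, hf, hk, hDev] with t g₁ g₂ g₃ gf gk gD
    have hlog := (((g₁.pow 2).add (g₂.pow 2)).sub_const (1 / 2 : ℝ)).log gD
    have hall := (gf.sub gk).sub (((hlog.sub ((g₃.pow 2).const_mul 6)).add_const C).const_mul ε)
    refine hall.congr_deriv ?_
    simp only [Pi.add_apply, Pi.pow_apply]
    push_cast
    ring
  · have hnum := ((c₁.mul h₁').add (c₂.mul h₂')).const_mul 2
    have hden := ((c₁.pow 2).add (c₂.pow 2)).sub_const (1 / 2 : ℝ)
    have hall := (hf'.sub hk').sub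
      (((hnum.div hden hD).sub ((c₃.mul h₃').const_mul 12)).const_mul ε)
    refine hall.congr_deriv ?_
    simp only [Pi.add_apply, Pi.mul_apply, Pi.pow_apply]
    set D := x₁ 0 ^ 2 + x₂ 0 ^ 2 - 1 / 2
    push_cast
    field_simp
    ring

/-- One-sided comparison: a bounded harmonic function dominated on the frontier by another one
is dominated by it everywhere, on a minimal piece in a slab and outside a cylinder. -/
lemma slab_outside_cylinder_le
    (U : Set ℂ) (hU : IsOpen U) (X₁ X₂ X₃ : ℂ → ℝ)
    (hsm₁ : ContDiffOn ℝ (⊤ : ℕ∞) X₁ U) (hsm₂ : ContDiffOn ℝ (⊤ : ℕ∞) X₂ U)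
    (hsm₃ : ContDiffOn ℝ (⊤ : ℕ∞) X₃ U)
    (hharm : ∀ z ∈ U, lap X₁ z = 0 ∧ lap X₂ z = 0 ∧ lap X₃ z = 0)
    (lam : ℂ → ℝ)
    (hconf : ∀ z ∈ U,
      pdx X₁ z * pdy X₁ z + pdx X₂ z * pdy X₂ z + pdx X₃ z * pdy X₃ z = 0)
    (hnormx : ∀ z ∈ U, (pdx X₁ z) ^ 2 + (pdx X₂ z) ^ 2 + (pdx X₃ z) ^ 2 = (lam z) ^ 2)
    (hnormy : ∀ z ∈ U, (pdy X₁ z) ^ 2 + (pdy X₂ z) ^ 2 + (pdy X₃ z) ^ 2 = (lam z) ^ 2)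
    (hlam : ∀ z ∈ U, 0 < lam z)
    (hcont₁ : ContinuousOn X₁ (closure U)) (hcont₂ : ContinuousOn X₂ (closure U))
    (hcont₃ : ContinuousOn X₃ (closure U))
    (hproper : ∀ K : Set (ℝ × ℝ × ℝ), IsCompact K →
      IsCompact {z ∈ closure U | (X₁ z, X₂ z, X₃ z) ∈ K})
    (b : ℝ)
    (hslab : ∀ z ∈ closure U, 0 ≤ X₃ z ∧ X₃ z ≤ b)
    (hcyl : ∀ z ∈ closure U, 1 ≤ (X₁ z) ^ 2 + (X₂ z) ^ 2)
    (f₁ f₂ : ℂ → ℝ)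
    (hf₁bdd : ∃ M : ℝ, ∀ z ∈ closure U, |f₁ z| ≤ M)
    (hf₂bdd : ∃ M : ℝ, ∀ z ∈ closure U, |f₂ z| ≤ M)
    (hf₁cont : ContinuousOn f₁ (closure U)) (hf₂cont : ContinuousOn f₂ (closure U))
    (hf₁sm : ContDiffOn ℝ (⊤ : ℕ∞) f₁ U) (hf₂sm : ContDiffOn ℝ (⊤ : ℕ∞) f₂ U)
    (hf₁harm : ∀ z ∈ U, lap f₁ z = 0) (hf₂harm : ∀ z ∈ U, lap f₂ z = 0)
    (hagree : ∀ z ∈ closure U \ U, f₁ z ≤ f₂ z) :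
    ∀ z ∈ closure U, f₁ z ≤ f₂ z := by
  obtain ⟨M₁, hM₁⟩ := hf₁bdd
  obtain ⟨M₂, hM₂⟩ := hf₂bdd
  intro z₀ hz₀
  by_contra! hlt
  set H : ℂ → ℝ := fun z =>
    Real.log (X₁ z ^ 2 + X₂ z ^ 2 - 1 / 2) - 6 * X₃ z ^ 2 + (Real.log 2 + 6 * b ^ 2) with hH
  have hHlog : ∀ z ∈ closure U,
      Real.log (X₁ z ^ 2 + X₂ z ^ 2 - 1 / 2) + Real.log 2 ≤ H z := fun z hz => by
    have := pow_le_pow_left₀ (hslab z hz).1 (hslab z hz).2 2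
    simp only [hH]
    linarith
  have hHnonneg : ∀ z ∈ closure U, 0 ≤ H z := fun z hz => by
    refine le_trans ?_ (hHlog z hz)
    have hc := hcyl z hz
    rw [← Real.log_mul (by linarith) (by norm_num)]
    exact Real.log_nonneg (by linarith)
  obtain ⟨ε, hε, hεz⟩ : ∃ ε > 0, 0 < f₁ z₀ - f₂ z₀ - ε * H z₀ := by
    have h0 := hHnonneg z₀ hz₀
    refine ⟨(f₁ z₀ - f₂ z₀) / (H z₀ + 1), div_pos (by linarith) (by linarith), ?_⟩
    rw [sub_pos, div_mul_eq_mul_div, div_lt_iff₀ (by linarith)]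
    nlinarith
  set W : ℂ → ℝ := fun z => f₁ z - f₂ z - ε * H z with hW
  set R : ℝ := Real.exp ((M₁ + M₂) / ε) + 1
  have hR1 : 1 ≤ R := by have := Real.exp_pos ((M₁ + M₂) / ε); linarith
  set K : Set ℂ := {z ∈ closure U | (X₁ z, X₂ z, X₃ z) ∈
    Set.Icc (-R) R ×ˢ Set.Icc (-R) R ×ˢ Set.Icc 0 b}
  have hKc : IsCompact K :=
    hproper _ (isCompact_Icc.prod (isCompact_Icc.prod isCompact_Icc))
  have hout : ∀ z ∈ closure U, z ∉ K → W z ≤ 0 := fun z hz hzK => by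
    have hbig : R ^ 2 ≤ X₁ z ^ 2 + X₂ z ^ 2 := by
      by_contra! hsmall
      refine hzK ⟨hz, abs_le.1 (abs_le_of_sq_le_sq (by nlinarith [sq_nonneg (X₂ z)]) (by linarith)),
        abs_le.1 (abs_le_of_sq_le_sq (by nlinarith [sq_nonneg (X₁ z)]) (by linarith)), hslab z hz⟩
    have hlogbig : (M₁ + M₂) / ε ≤ Real.log (X₁ z ^ 2 + X₂ z ^ 2 - 1 / 2) := by
      rw [Real.le_log_iff_exp_le (by nlinarith)]
      nlinarith
    have hle : (M₁ + M₂) / ε ≤ H z := by linarith [hHlog z hz, Real.log_nonneg one_le_two]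
    rw [div_le_iff₀ hε] at hle
    have h1 := (abs_le.1 (hM₁ z hz)).2
    have h2 := (abs_le.1 (hM₂ z hz)).1
    simp only [hW]
    linarith
  have hWc : ContinuousOn W (closure U) := by
    have hlogc : ContinuousOn (fun z => Real.log (X₁ z ^ 2 + X₂ z ^ 2 - 1 / 2)) (closure U) :=
      (((hcont₁.pow 2).add (hcont₂.pow 2)).sub continuousOn_const).log
        fun z hz =>
          (show 0 < X₁ z ^ 2 + X₂ z ^ 2 - 1 / 2 by linarith [hcyl z hz]).ne'
    exact (hf₁cont.sub hf₂cont).sub (continuousOn_const.mul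
      ((hlogc.sub (continuousOn_const.mul (hcont₃.pow 2))).add continuousOn_const))
  have hz₀K : z₀ ∈ K := by
    by_contra h
    exact absurd (hout z₀ hz₀ h) (not_le.2 hεz)
  obtain ⟨z, hzK, hzmax⟩ := hKc.exists_isMaxOn ⟨z₀, hz₀K⟩ (hWc.mono fun w hw => hw.1)
  have hWz : 0 < W z := lt_of_lt_of_le hεz (hzmax hz₀K)
  have hzU : z ∈ U := by
    by_contra h
    have h1 := hagree z ⟨hzK.1, h⟩
    have h2 := mul_nonneg hε.le (hHnonneg z hzK.1)
    simp only [hW] at hWz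
    linarith
  have hlocal : IsLocalMax W z := by
    filter_upwards [hU.mem_nhds hzU] with w hw
    by_cases hwK : w ∈ K
    · exact hzmax hwK
    · exact (hout w (subset_closure hw) hwK).trans hWz.le
  have hlineMax : ∀ e : ℂ, IsLocalMax (fun t : ℝ => W (z + t * e)) 0 := fun e => by
    have hline : Filter.Tendsto (fun t : ℝ => z + t * e) (nhds 0) (nhds z) :=
      Continuous.tendsto' (by fun_prop) _ _ (by simp)
    simpa [IsLocalMax, IsMaxFilter] using hline.eventually hlocal
  have htest : ∀ e : ℂ, _ := fun e =>
    have g₁ := line_hasDerivAt hU hsm₁ hzU e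
    have g₂ := line_hasDerivAt hU hsm₂ hzU e
    have g₃ := line_hasDerivAt hU hsm₃ hzU e
    have gf := line_hasDerivAt hU hf₁sm hzU e
    have gk := line_hasDerivAt hU hf₂sm hzU e
    line_barrier_test (ε := ε) (C := Real.log 2 + 6 * b ^ 2) g₁.1 g₁.2 g₂.1 g₂.2 g₃.1 g₃.2
      gf.1 gf.2 gk.1 gk.2 (by simpa using hcyl z hzK.1) (hlineMax e)
  have hx := htest 1
  have hy := htest Complex.I
  obtain ⟨l₁, l₂, l₃⟩ := hharm z hzU
  have lf₁ := hf₁harm z hzU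
  have lf₂ := hf₂harm z hzU
  have hneg := barrier_laplacian_neg (hlam z hzU) (hconf z hzU) (hnormx z hzU) (hnormy z hzU)
    (hcyl z hzK.1)
  simp only [Complex.ofReal_zero, zero_mul, add_zero] at hx hy
  change pdx (pdx f₁) z - pdx (pdx f₂) z - ε * ((2 * (pdx X₁ z ^ 2 + pdx X₂ z ^ 2) +
    2 * (X₁ z * pdx (pdx X₁) z + X₂ z * pdx (pdx X₂) z)) / (X₁ z ^ 2 + X₂ z ^ 2 - 1 / 2)
    - 4 * (X₁ z * pdx X₁ z + X₂ z * pdx X₂ z) ^ 2 / (X₁ z ^ 2 + X₂ z ^ 2 - 1 / 2) ^ 2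
    - 12 * (pdx X₃ z ^ 2 + X₃ z * pdx (pdx X₃) z)) ≤ 0 at hx
  change pdy (pdy f₁) z - pdy (pdy f₂) z - ε * ((2 * (pdy X₁ z ^ 2 + pdy X₂ z ^ 2) +
    2 * (X₁ z * pdy (pdy X₁) z + X₂ z * pdy (pdy X₂) z)) / (X₁ z ^ 2 + X₂ z ^ 2 - 1 / 2)
    - 4 * (X₁ z * pdy X₁ z + X₂ z * pdy X₂ z) ^ 2 / (X₁ z ^ 2 + X₂ z ^ 2 - 1 / 2) ^ 2
    - 12 * (pdy X₃ z ^ 2 + X₃ z * pdy (pdy X₃) z)) ≤ 0 at hy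
  simp only [lap] at l₁ l₂ l₃ lf₁ lf₂
  have hpos := mul_neg_of_pos_of_neg hε hneg
  rw [← eq_neg_iff_add_eq_zero] at l₁ l₂ l₃ lf₁ lf₂
  rw [l₁, l₂, l₃, lf₁, lf₂] at hx
  simp only [div_eq_mul_inv] at hx hy hpos
  linarith

/-- Key step of Theorem 3.1 of the paper: a conformally parametrized, properly immersed
minimal piece lying in a horizontal slab `0 ≤ x₃ ≤ b` and outside the vertical cylinder
`x₁² + x₂² ≥ 1` is parabolic: bounded continuous functions on `closure U` that are
harmonic on `U` are determined by their values on the frontier `closure U \ U`. -/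
theorem slab_outside_cylinder_parabolic
    (U : Set ℂ) (hU : IsOpen U) (X₁ X₂ X₃ : ℂ → ℝ)
    (hsm₁ : ContDiffOn ℝ (⊤ : ℕ∞) X₁ U) (hsm₂ : ContDiffOn ℝ (⊤ : ℕ∞) X₂ U)
    (hsm₃ : ContDiffOn ℝ (⊤ : ℕ∞) X₃ U)
    (hharm : ∀ z ∈ U, lap X₁ z = 0 ∧ lap X₂ z = 0 ∧ lap X₃ z = 0)
    (lam : ℂ → ℝ)
    (hconf : ∀ z ∈ U,
      pdx X₁ z * pdy X₁ z + pdx X₂ z * pdy X₂ z + pdx X₃ z * pdy X₃ z = 0)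
    (hnormx : ∀ z ∈ U, (pdx X₁ z) ^ 2 + (pdx X₂ z) ^ 2 + (pdx X₃ z) ^ 2 = (lam z) ^ 2)
    (hnormy : ∀ z ∈ U, (pdy X₁ z) ^ 2 + (pdy X₂ z) ^ 2 + (pdy X₃ z) ^ 2 = (lam z) ^ 2)
    (hlam : ∀ z ∈ U, 0 < lam z)
    (hcont₁ : ContinuousOn X₁ (closure U)) (hcont₂ : ContinuousOn X₂ (closure U))
    (hcont₃ : ContinuousOn X₃ (closure U))
    (hproper : ∀ K : Set (ℝ × ℝ × ℝ), IsCompact K →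
      IsCompact {z ∈ closure U | (X₁ z, X₂ z, X₃ z) ∈ K})
    (b : ℝ)
    (hslab : ∀ z ∈ closure U, 0 ≤ X₃ z ∧ X₃ z ≤ b)
    (hcyl : ∀ z ∈ closure U, 1 ≤ (X₁ z) ^ 2 + (X₂ z) ^ 2)
    (f₁ f₂ : ℂ → ℝ)
    (hf₁bdd : ∃ M : ℝ, ∀ z ∈ closure U, |f₁ z| ≤ M)
    (hf₂bdd : ∃ M : ℝ, ∀ z ∈ closure U, |f₂ z| ≤ M)
    (hf₁cont : ContinuousOn f₁ (closure U)) (hf₂cont : ContinuousOn f₂ (closure U))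
    (hf₁sm : ContDiffOn ℝ (⊤ : ℕ∞) f₁ U) (hf₂sm : ContDiffOn ℝ (⊤ : ℕ∞) f₂ U)
    (hf₁harm : ∀ z ∈ U, lap f₁ z = 0) (hf₂harm : ∀ z ∈ U, lap f₂ z = 0)
    (hagree : ∀ z ∈ closure U \ U, f₁ z = f₂ z) :
    ∀ z ∈ closure U, f₁ z = f₂ z := by
  intro z hz
  refine le_antisymm ?_ ?_
  · exact slab_outside_cylinder_le U hU X₁ X₂ X₃ hsm₁ hsm₂ hsm₃ hharm lam hconf hnormx hnormy
      hlam hcont₁ hcont₂ hcont₃ hproper b hslab hcyl f₁ f₂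
      hf₁bdd hf₂bdd hf₁cont hf₂cont hf₁sm hf₂sm hf₁harm hf₂harm
      (fun w hw => (hagree w hw).le) z hz
  · exact slab_outside_cylinder_le U hU X₁ X₂ X₃ hsm₁ hsm₂ hsm₃ hharm lam hconf hnormx hnormy
      hlam hcont₁ hcont₂ hcont₃ hproper b hslab hcyl f₂ f₁
      hf₂bdd hf₁bdd hf₂cont hf₁cont hf₂sm hf₁sm hf₂harm hf₁harm
      (fun w hw => (hagree w hw).ge) z hz
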